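/- Let α > 0 and let n be an integer with |n| ≥ 1. Suppose R and κ satisfy R > ( 6(1 + n²(2 ln 2 − 1)) / (α⁻¹ − κ) )^{1/2} and −(n² + r₀²)/(2R²) < κ < α⁻¹ − (n² + r₀²)/(2R²). Then there exists a classical solution u of the n-vortex equation with parameters (α, n, κ, R) such that u has finite energy and u(r) > 0 for all r ∈ (0,R). -/

import Mathlib

open MeasureTheory Set Filter

noncomputable section

/-- The Bessel function `J₀`. -/
def besselJ0 (x : ℝ) : ℝ :=
  ∑' m : ℕ, (-1 : ℝ) ^ m * (x / 2) ^ (2 * m) / ((Nat.factorial m : ℝ)) ^ 2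

/-- The smallest positive zero of `J₀` (≈ 2.404826). -/
def besselR0 : ℝ := sInf {x : ℝ | 0 < x ∧ besselJ0 x = 0}

/-- `u` is a classical solution of the `n`-vortex equation with parameters `(α, n, κ, R)`. -/
def IsVortexSol (α : ℝ) (n : ℤ) (κ R : ℝ) (u : ℝ → ℝ) : Prop :=
  ContinuousOn u (Icc 0 R) ∧
  (∀ r ∈ Ioo (0 : ℝ) R, DifferentiableAt ℝ u r ∧ DifferentiableAt ℝ (deriv u) r) ∧
  u 0 = 0 ∧ u R = 0 ∧
  ∀ r ∈ Ioo (0 : ℝ) R,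
    deriv (fun s => s * deriv u s) r - ((n : ℝ) ^ 2 / r) * u r
      + 2 * r * (u r) ^ 3 / (1 + α * (u r) ^ 2) - 2 * κ * r * u r = 0

/-- `u` has finite energy. -/
def FiniteEnergy (α R : ℝ) (u : ℝ → ℝ) : Prop :=
  IntegrableOn
    (fun r => r * (deriv u r) ^ 2 + (u r) ^ 2 / r + r * Real.log (1 + α * (u r) ^ 2))
    (Ioo 0 R)

/-- The energy flux `Q(u) = 2π ∫₀^R r u(r)² dr`. -/
def fluxQ (R : ℝ) (u : ℝ → ℝ) : ℝ := 2 * Real.pi * ∫ r in Ioo (0 : ℝ) R, r * (u r) ^ 2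

/-- The tent function with parameters `a` and `b`. -/
def tent (a b : ℝ) : ℝ → ℝ := fun r => if r ≤ a then (b / a) * r else (b / a) * (2 * a - r)

/-- The action functional `I_κ`. -/
def actI (α : ℝ) (n : ℤ) (κ R : ℝ) (u : ℝ → ℝ) : ℝ :=
  (1 / 2) * ∫ r in Ioo (0 : ℝ) R,
    (r * (deriv u r) ^ 2 + ((n : ℝ) ^ 2 / r) * (u r) ^ 2
      - 2 * (α⁻¹ - κ) * r * (u r) ^ 2 + 2 * (α ^ 2)⁻¹ * r * Real.log (1 + α * (u r) ^ 2))

/-- The action functional `𝓘`. -/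
def actI0 (α : ℝ) (n : ℤ) (R : ℝ) (u : ℝ → ℝ) : ℝ :=
  (1 / 2) * ∫ r in Ioo (0 : ℝ) R,
    (r * (deriv u r) ^ 2 + ((n : ℝ) ^ 2 / r) * (u r) ^ 2
      - 2 * α⁻¹ * r * (u r) ^ 2 + 2 * (α ^ 2)⁻¹ * r * Real.log (1 + α * (u r) ^ 2))

/-- The functional `γ_κ`. -/
def gammaK (α : ℝ) (n : ℤ) (κ R : ℝ) (u : ℝ → ℝ) : ℝ :=
  (1 / 2) * ∫ r in Ioo (0 : ℝ) R,
    (r * (deriv u r) ^ 2 + ((n : ℝ) ^ 2 / r) * (u r) ^ 2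
      - 2 * (α⁻¹ - κ) * r * (u r) ^ 2 + 2 * α⁻¹ * r * (u r) ^ 2 / (1 + α * (u r) ^ 2))

/-- Membership in the class `X`. -/
def MemX (R : ℝ) (u : ℝ → ℝ) : Prop :=
  ContinuousOn u (Icc 0 R) ∧ ContDiffOn ℝ 1 u (Ioo 0 R) ∧ u 0 = 0 ∧ u R = 0 ∧
    IntegrableOn (fun r => r * (deriv u r) ^ 2 + (u r) ^ 2 / r) (Ioo 0 R)

/-- Membership in the class `X`, allowing finitely many exceptional points. -/
def MemX' (R : ℝ) (u : ℝ → ℝ) : Prop :=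
  ContinuousOn u (Icc 0 R) ∧ (∃ S : Finset ℝ, ContDiffOn ℝ 1 u (Ioo 0 R \ ↑S)) ∧
    u 0 = 0 ∧ u R = 0 ∧
    IntegrableOn (fun r => r * (deriv u r) ^ 2 + (u r) ^ 2 / r) (Ioo 0 R)

/-- The admissible class `𝒜`. -/
def Admissible (α R : ℝ) (v : ℝ → ℝ) : Prop :=
  (∃ K : NNReal, LipschitzOnWith K v (Icc 0 R)) ∧ v 0 = 0 ∧ v R = 0 ∧ FiniteEnergy α R v

end

/-- `J₀` in the variable `x²/4`. -/
noncomputable def besA (y : ℝ) : ℝ := ∑' m : ℕ, (-1 : ℝ) ^ m * y ^ m / ((Nat.factorial m : ℝ)) ^ 2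

/-- companion series -/
noncomputable def besD (y : ℝ) : ℝ :=
  ∑' m : ℕ, (-1 : ℝ) ^ m * y ^ (m + 1) / ((Nat.factorial m : ℝ) * (Nat.factorial (m + 1) : ℝ))

/-- companion series -/
noncomputable def besB (y : ℝ) : ℝ :=
  ∑' m : ℕ, (-1 : ℝ) ^ m * y ^ m / ((Nat.factorial m : ℝ) * (Nat.factorial (m + 1) : ℝ))

theorem besselJ0_eq (x : ℝ) : besselJ0 x = besA (x ^ 2 / 4) := by
  unfold besselJ0 besA
  congr 1; funext m
  rw [pow_mul]; congr 3; ring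

theorem besD_eq (y : ℝ) : besD y = y * besB y := by
  unfold besD besB
  rw [← tsum_mul_left]
  congr 1; funext m; ring

theorem fac_one_le (m : ℕ) : (1:ℝ) ≤ (Nat.factorial m : ℝ) := by
  exact_mod_cast Nat.one_le_iff_ne_zero.2 (Nat.factorial_ne_zero m)

theorem besB_term_le (M y : ℝ) (hy : |y| ≤ M) (m : ℕ) (c : ℝ) (hc : 1 ≤ c) :
    ‖(-1 : ℝ) ^ m * y ^ m / ((Nat.factorial m : ℝ) * c)‖ ≤ M ^ m / (Nat.factorial m : ℝ) := by
  have h1 := fac_one_le m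
  have hM : 0 ≤ M := (abs_nonneg y).trans hy
  rw [Real.norm_eq_abs, abs_div, abs_mul, abs_pow, abs_pow, abs_neg, abs_one, one_pow, one_mul,
    abs_of_pos (by positivity : 0 < (Nat.factorial m : ℝ) * c)]
  gcongr
  nlinarith

theorem besA_deriv (y : ℝ) : HasDerivAt besA (-besB y) y := by
  have hM : ∃ M, |y| < M := exists_gt _
  obtain ⟨M, hM⟩ := hM
  have hM0 : 0 < M := (abs_nonneg y).trans_lt hM
  have key : HasDerivAt besA (∑' m : ℕ, 
      (-1 : ℝ) ^ m * ((m : ℝ) * y ^ (m - 1)) / ((Nat.factorial m : ℝ)) ^ 2) y := by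
    refine hasDerivAt_tsum_of_isPreconnected (t := Metric.ball 0 M) (y₀ := 0)
      (u := fun m => M ^ (m - 1) / ((m - 1).factorial : ℝ)) 
      (g := fun (m : ℕ) y => (-1 : ℝ) ^ m * y ^ m / ((Nat.factorial m : ℝ)) ^ 2)
      (g' := fun (m : ℕ) y => (-1 : ℝ) ^ m * ((m : ℝ) * y ^ (m - 1)) / ((Nat.factorial m : ℝ)) ^ 2)
      ?_ Metric.isOpen_ball
      (convex_ball _ _).isPreconnected ?_ ?_ (Metric.mem_ball_self hM0) ?_ (by simpa using hM)
    · rw [← summable_nat_add_iff 1]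
      simpa using Real.summable_pow_div_factorial M
    · intro m z hz
      have := ((hasDerivAt_pow m z).const_mul ((-1:ℝ)^m)).div_const ((Nat.factorial m : ℝ) ^ 2)
      exact this
    · intro m z hz
      rcases m with _ | m
      · simp
      · have := besB_term_le M z (by simpa using (Metric.mem_ball.1 hz).le) m
          ((m+1).factorial) (fac_one_le _)
        simp only [Nat.add_sub_cancel]
        refine le_trans (le_of_eq ?_) this
        have h2 : (-1 : ℝ) ^ (m+1) * (((m+1:ℕ):ℝ) * z ^ m) / (((m+1).factorial : ℝ)) ^ 2 
          = -((-1 : ℝ) ^ m * z ^ m / ((Nat.factorial m : ℝ) * ((m+1).factorial : ℝ))) := by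
          have := Nat.factorial_ne_zero m
          rw [Nat.factorial_succ]; push_cast; field_simp; ring
        rw [h2, norm_neg]
    · apply summable_of_ne_finset_zero (s := {0})
      intro m hm
      simp at hm
      simp [hm]
  convert key using 1
  have hs : Summable fun m : ℕ => 
      (-1 : ℝ) ^ m * ((m : ℝ) * y ^ (m - 1)) / ((Nat.factorial m : ℝ)) ^ 2 := by
    rw [← summable_nat_add_iff 1]
    refine Summable.of_norm_bounded (Real.summable_pow_div_factorial M) ?_
    intro m
    have := besB_term_le M y hM.le m ((m+1).factorial) (fac_one_le _)
    refine le_trans (le_of_eq ?_) this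
    have h2 : (-1 : ℝ) ^ (m+1) * (((m+1:ℕ):ℝ) * y ^ (m + 1 - 1)) / (((m+1).factorial : ℝ)) ^ 2 
      = -((-1 : ℝ) ^ m * y ^ m / ((Nat.factorial m : ℝ) * ((m+1).factorial : ℝ))) := by
      have := Nat.factorial_ne_zero m
      rw [Nat.factorial_succ, Nat.add_sub_cancel]; push_cast; field_simp; ring
    rw [h2, norm_neg]
  rw [hs.tsum_eq_zero_add]
  simp only [besB, ← tsum_neg]
  simp only [Nat.cast_zero, zero_mul, mul_zero, zero_div, zero_add]
  congr 1; funext m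
  have := Nat.factorial_ne_zero m
  rw [Nat.factorial_succ, Nat.add_sub_cancel]; push_cast; field_simp; ring

theorem besD_deriv (y : ℝ) : HasDerivAt besD (besA y) y := by
  obtain ⟨M, hM⟩ : ∃ M, |y| < M := exists_gt _
  have hM0 : 0 < M := (abs_nonneg y).trans_lt hM
  refine hasDerivAt_tsum_of_isPreconnected (t := Metric.ball 0 M) (y₀ := 0)
      (u := fun m => M ^ m / (m.factorial : ℝ)) 
      (g := fun (m : ℕ) y => (-1 : ℝ) ^ m * y ^ (m + 1) / 
        ((Nat.factorial m : ℝ) * (Nat.factorial (m + 1) : ℝ)))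
      (g' := fun (m : ℕ) y => (-1 : ℝ) ^ m * y ^ m / ((Nat.factorial m : ℝ)) ^ 2)
      (Real.summable_pow_div_factorial M) Metric.isOpen_ball
      (convex_ball _ _).isPreconnected ?_ ?_ (Metric.mem_ball_self hM0) ?_ (by simpa using hM)
  · intro m z hz
    have := ((hasDerivAt_pow (m+1) z).const_mul ((-1:ℝ)^m)).div_const 
      ((Nat.factorial m : ℝ) * (Nat.factorial (m + 1) : ℝ))
    refine HasDerivAt.congr_deriv this ?_
    have := Nat.factorial_ne_zero m
    rw [Nat.factorial_succ, Nat.add_sub_cancel]; push_cast; field_simp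
  · intro m z hz
    have := besB_term_le M z (by simpa using (Metric.mem_ball.1 hz).le) m
          (m.factorial) (fac_one_le _)
    rw [← sq] at this
    exact this
  · simp [summable_zero]

theorem besA_zero : besA 0 = 1 := by
  unfold besA
  rw [tsum_eq_single 0]
  · simp
  · intro m hm; simp [hm]

theorem besselJ0_cont : Continuous besselJ0 := by
  have h : besselJ0 = fun x => besA (x ^ 2 / 4) := funext besselJ0_eq
  have h2 : Continuous besA := continuous_iff_continuousAt.2 fun r => (besA_deriv r).continuousAt
  rw [h]; fun_prop

theorem besselR0_nonneg : 0 ≤ besselR0 := by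
  apply Real.sInf_nonneg
  rintro x ⟨hx, -⟩; exact hx.le

theorem besselJ0_pos (x : ℝ) (hx : 0 ≤ x) (h : x < besselR0) : 0 < besselJ0 x := by
  by_contra hneg
  push Not at hneg
  have h0 : besselJ0 0 = 1 := by rw [besselJ0_eq]; simp [besA_zero]
  obtain ⟨c, hc, hc0⟩ : ∃ c ∈ Icc 0 x, besselJ0 c = 0 := by
    have := intermediate_value_Icc' hx besselJ0_cont.continuousOn
    exact this ⟨hneg, by rw [h0]; exact zero_le_one⟩
  have hcpos : 0 < c := by
    rcases hc.1.eq_or_lt with h | h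
    · rw [← h, h0] at hc0; norm_num at hc0
    · exact h
  have : besselR0 ≤ c := csInf_le ⟨0, fun y hy => hy.1.le⟩ ⟨hcpos, hc0⟩
  linarith [hc.2]

/-- The comparison function on `[0,R]`. -/
theorem bes_compare (R : ℝ) (hR : 0 < R) : ∃ w D : ℝ → ℝ, Continuous w ∧ Continuous D ∧ D 0 = 0 ∧
    (∀ r ∈ Ico 0 R, 0 < w r) ∧ 0 ≤ w R ∧ (∀ r, 0 < r → HasDerivAt w (D r / r) r) ∧
    (∀ r, HasDerivAt D (-(besselR0 ^ 2 / R ^ 2 * r * w r)) r) := by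
  set c : ℝ := besselR0 ^ 2 / (4 * R ^ 2) with hc
  have hA : Continuous besA := continuous_iff_continuousAt.2 fun r => (besA_deriv r).continuousAt
  have hD : Continuous besD := continuous_iff_continuousAt.2 fun r => (besD_deriv r).continuousAt
  have hw : Continuous fun r : ℝ => besA (c * r ^ 2) := by fun_prop
  have hin : ∀ r : ℝ, HasDerivAt (fun r : ℝ => c * r ^ 2) (c * (2 * r)) r := by
    intro r
    simpa using (hasDerivAt_pow 2 r).const_mul c
  have hpos : ∀ r ∈ Ico 0 R, 0 < besA (c * r ^ 2) := by
    intro r hr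
    rcases besselR0_nonneg.eq_or_lt with h | h
    · have : c = 0 := by rw [hc, ← h]; simp
      rw [this, zero_mul, besA_zero]; exact one_pos
    · have h1 := besselJ0_pos (besselR0 * r / R) (div_nonneg (mul_nonneg h.le hr.1) hR.le)
        (by rw [div_lt_iff₀ hR]; exact mul_lt_mul_of_pos_left hr.2 h)
      rw [besselJ0_eq] at h1
      convert h1 using 2
      rw [hc]; field_simp
  refine ⟨fun r => besA (c * r ^ 2), fun r => -2 * besD (c * r ^ 2), hw, by fun_prop, ?_, hpos, 
    ?_, ?_, ?_⟩
  · simp [besD_eq]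
  · have : R ∈ closure (Ico 0 R) := by
      rw [closure_Ico hR.ne]; exact ⟨hR.le, le_rfl⟩
    exact closure_minimal (t := {r | 0 ≤ besA (c * r ^ 2)}) (fun r hr => (hpos r hr).le)
      (isClosed_le continuous_const hw) this
  · intro r hr
    have := (besA_deriv (c * r ^ 2)).comp r (hin r)
    refine HasDerivAt.congr_deriv this ?_
    beta_reduce; rw [besD_eq]; field_simp
  · intro r
    have := ((besD_deriv (c * r ^ 2)).comp r (hin r)).const_mul (-2)
    refine HasDerivAt.congr_deriv this ?_
    rw [hc]; field_simp; ring

/-- radial derivative profile -/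
noncomputable def vP (k : ℕ) (w : ℝ → ℝ) (s : ℝ) : ℝ := -(s * ∫ τ in (0:ℝ)..1, τ ^ k * w (s * τ))

/-- radial profile -/
noncomputable def vV (k : ℕ) (a : ℝ) (w : ℝ → ℝ) (r : ℝ) : ℝ := a + ∫ s in (0:ℝ)..r, vP k w s

theorem vP_cont (k : ℕ) (w : ℝ → ℝ) (hw : Continuous w) : Continuous (vP k w) := by
  unfold vP
  refine (continuous_id.mul ?_).neg
  apply intervalIntegral.continuous_parametric_intervalIntegral_of_continuous'
  fun_prop

theorem vV_deriv (k : ℕ) (a : ℝ) (w : ℝ → ℝ) (hw : Continuous w) (r : ℝ) :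
    HasDerivAt (vV k a w) (vP k w r) r := by
  unfold vV
  exact ((vP_cont k w hw).integral_hasStrictDerivAt 0 r).hasDerivAt.const_add a

theorem vP_deriv (k : ℕ) (w : ℝ → ℝ) (hw : Continuous w) (r : ℝ) :
    HasDerivAt (fun s => s ^ k * vP k w s) (-(r ^ k * w r)) r := by
  have h : (fun s => s ^ k * vP k w s) = fun s => -∫ t in (0:ℝ)..s, t ^ k * w t := by
    funext s
    have h1 := intervalIntegral.mul_integral_comp_mul_left (a := 0) (b := 1)
      (f := fun t => t ^ k * w t) (c := s)
    simp only [mul_zero, mul_one] at h1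
    rw [← h1]
    unfold vP
    have h2 : (∫ x in (0:ℝ)..1, (s * x) ^ k * w (s * x)) 
        = s ^ k * ∫ x in (0:ℝ)..1, x ^ k * w (s * x) := by
      rw [← intervalIntegral.integral_const_mul]
      congr 1; funext x; ring
    rw [h2]; ring
  rw [h]
  have hc : Continuous fun t => t ^ k * w t := by fun_prop
  exact ((hc.integral_hasStrictDerivAt 0 r).hasDerivAt).neg

theorem vP_diff (k : ℕ) (w w' : ℝ → ℝ) (hw : Continuous w) (hw' : Continuous w') (s B : ℝ)
    (hs : 0 ≤ s) (h : ∀ t ∈ Icc 0 s, |w t - w' t| ≤ B) :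
    |vP k w s - vP k w' s| ≤ s * B := by
  unfold vP
  have h1 : (-(s * ∫ τ in (0:ℝ)..1, τ ^ k * w (s * τ))) - (-(s * ∫ τ in (0:ℝ)..1, τ ^ k * w' (s * τ)))
      = -(s * ∫ τ in (0:ℝ)..1, τ ^ k * (w (s * τ) - w' (s * τ))) := by
    have : (∫ τ in (0:ℝ)..1, τ ^ k * (w (s * τ) - w' (s * τ))) 
      = (∫ τ in (0:ℝ)..1, τ ^ k * w (s * τ)) - ∫ τ in (0:ℝ)..1, τ ^ k * w' (s * τ) := by
      rw [← intervalIntegral.integral_sub]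
      · congr 1; funext x; ring
      · apply Continuous.intervalIntegrable; fun_prop
      · apply Continuous.intervalIntegrable; fun_prop
    rw [this]; ring
  rw [h1, abs_neg, abs_mul, abs_of_nonneg hs]
  refine mul_le_mul_of_nonneg_left ?_ hs
  have := intervalIntegral.norm_integral_le_of_norm_le_const (a := (0:ℝ)) (b := 1) (C := B)
    (f := fun τ => τ ^ k * (w (s * τ) - w' (s * τ))) ?_
  · simpa using this
  · intro x hx
    rw [uIoc_of_le zero_le_one] at hx
    rw [Real.norm_eq_abs, abs_mul, abs_of_nonneg (pow_nonneg hx.1.le k)]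
    have h2 := h (s * x) ⟨mul_nonneg hs hx.1.le, by nlinarith [hx.2]⟩
    calc x ^ k * |w (s * x) - w' (s * x)| ≤ 1 * |w (s * x) - w' (s * x)| :=
          mul_le_mul_of_nonneg_right (pow_le_one₀ hx.1.le hx.2) (abs_nonneg _)
      _ ≤ B := by linarith

/-- Solutions of the desingularised radial problem. -/
structure RadSol (k : ℕ) (R : ℝ) (q : ℝ → ℝ → ℝ) (a : ℝ) (V P : ℝ → ℝ) : Prop where
  V0 : V 0 = a
  dV : ∀ r, HasDerivAt V (P r) r
  cP : Continuous P
  dP : ∀ r ∈ Icc 0 R, HasDerivAt (fun s => s ^ k * P s) (-(r ^ k * q r (V r))) r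

theorem RadSol.cV {k : ℕ} {R : ℝ} {q : ℝ → ℝ → ℝ} {a : ℝ} {V P : ℝ → ℝ}
    (h : RadSol k R q a V P) : Continuous V :=
  continuous_iff_continuousAt.2 fun r => (h.dV r).continuousAt

theorem rad_exists (k : ℕ) (R : ℝ) (hR : 0 < R) (q : ℝ → ℝ → ℝ)
    (hq : Continuous (Function.uncurry q)) (L : ℝ) (hL : 0 < L)
    (hLip : ∀ r x y, |q r x - q r y| ≤ L * |x - y|) (hq0 : ∀ r, q r 0 = 0) :
    ∃ V P : ℝ → ℝ → ℝ, (∀ a, RadSol k R q a (V a) (P a)) ∧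
      ∃ C > 0, (∀ a b, ∀ r ∈ Icc 0 R, |V a r - V b r| ≤ C * |a - b|) ∧
        (∀ a, ∀ r ∈ Icc 0 R, |V a r| ≤ C * |a|) ∧ (∀ a, ∀ r ∈ Icc 0 R, |P a r| ≤ C * |a|) := by
  set l : ℝ := 2 * (R * L) with hl
  have hlpos : 0 < l := by positivity
  let W : C(Icc (0:ℝ) R, ℝ) → ℝ → ℝ := fun z t => q t (Real.exp (l * t) * IccExtend hR.le z t)
  have hW : ∀ z, Continuous (W z) := by
    intro z
    have h1 : Continuous (IccExtend hR.le z) := z.continuous.Icc_extend'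
    have : Continuous fun t => (t, Real.exp (l * t) * IccExtend hR.le z t) := by fun_prop
    exact hq.comp this
  have hVc : ∀ a z, Continuous (vV k a (W z)) := fun a z =>
    continuous_iff_continuousAt.2 fun r => (vV_deriv k a _ (hW z) r).continuousAt
  let T : ℝ → C(Icc (0:ℝ) R, ℝ) → C(Icc (0:ℝ) R, ℝ) := fun a z =>
    ⟨fun r => Real.exp (-(l * r)) * vV k a (W z) r, by
      have := hVc a z
      fun_prop⟩
  have hWd : ∀ z z' t, 0 ≤ t → t ≤ R → ∀ s, t ≤ s → 
      |W z t - W z' t| ≤ L * (Real.exp (l * s) * dist z z') := by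
    intro z z' t ht0 htR s hts
    refine (hLip _ _ _).trans ?_
    refine mul_le_mul_of_nonneg_left ?_ hL.le
    rw [← mul_sub, abs_mul, abs_of_pos (Real.exp_pos _), IccExtend_of_mem _ _ ⟨ht0, htR⟩,
      IccExtend_of_mem _ _ ⟨ht0, htR⟩]
    have := ContinuousMap.dist_apply_le_dist (f := z) (g := z') ⟨t, ht0, htR⟩
    rw [Real.dist_eq] at this
    have h3 : Real.exp (l * t) ≤ Real.exp (l * s) := 
      Real.exp_le_exp.2 (mul_le_mul_of_nonneg_left hts hlpos.le)
    gcongr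
  have hPd : ∀ z z' s, 0 ≤ s → s ≤ R → 
      |vP k (W z) s - vP k (W z') s| ≤ R * L * dist z z' * Real.exp (l * s) := by
    intro z z' s hs hsR
    refine (vP_diff k _ _ (hW z) (hW z') s (L * (Real.exp (l * s) * dist z z')) hs ?_).trans ?_
    · intro t ht
      exact hWd z z' t ht.1 (ht.2.trans hsR) s ht.2
    · have : 0 ≤ L * (Real.exp (l * s) * dist z z') := by positivity
      nlinarith
  have hT : ∀ a, ContractingWith (1/2) (T a) := by
    intro a
    refine ⟨by
      rw [← NNReal.coe_lt_coe]; norm_num, LipschitzWith.of_dist_le_mul ?_⟩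
    intro z z'
    rw [ContinuousMap.dist_le (by positivity)]
    rintro ⟨r, hr0, hrR⟩
    rw [Real.dist_eq]
    change |Real.exp (-(l * r)) * vV k a (W z) r - Real.exp (-(l * r)) * vV k a (W z') r| ≤ _
    rw [← mul_sub, abs_mul, abs_of_pos (Real.exp_pos _)]
    have h1 : vV k a (W z) r - vV k a (W z') r 
        = ∫ s in (0:ℝ)..r, (vP k (W z) s - vP k (W z') s) := by
      unfold vV
      rw [intervalIntegral.integral_sub]
      · ring
      · exact (vP_cont k _ (hW z)).intervalIntegrable _ _
      · exact (vP_cont k _ (hW z')).intervalIntegrable _ _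
    have h2 : ‖∫ s in (0:ℝ)..r, (vP k (W z) s - vP k (W z') s)‖ ≤
        ∫ s in (0:ℝ)..r, R * L * dist z z' * Real.exp (l * s) := by
      apply intervalIntegral.norm_integral_le_of_norm_le hr0
      · refine Eventually.of_forall fun s hs => ?_
        exact hPd z z' s hs.1.le (hs.2.trans hrR)
      · apply Continuous.intervalIntegrable; fun_prop
    have h3 : ∫ s in (0:ℝ)..r, R * L * dist z z' * Real.exp (l * s) = 
        R * L * dist z z' * ((Real.exp (l * r) - 1) / l) := by
      rw [intervalIntegral.integral_const_mul]
      congr 1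
      have := intervalIntegral.mul_integral_comp_mul_left (a := 0) (b := r)
        (f := fun t => Real.exp t) (c := l)
      rw [integral_exp] at this
      field_simp
      rw [this]; simp
    rw [h1]
    rw [Real.norm_eq_abs, h3] at h2
    have h4 : R * L * dist z z' * ((Real.exp (l * r) - 1) / l) 
        = (1/2) * dist z z' * (Real.exp (l * r) - 1) := by
      rw [hl]; field_simp
    rw [h4] at h2
    calc _ ≤ Real.exp (-(l * r)) * ((1/2) * dist z z' * (Real.exp (l * r) - 1)) := by gcongr
      _ ≤ Real.exp (-(l * r)) * ((1/2) * dist z z' * (Real.exp (l * r))) := by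
        gcongr; linarith
      _ = (1/2) * dist z z' * (Real.exp (-(l * r)) * Real.exp (l * r)) := by ring
      _ = _ := by rw [← Real.exp_add]; simp
  have : Nonempty (C(Icc (0:ℝ) R, ℝ)) := ⟨0⟩
  let Z : ℝ → C(Icc (0:ℝ) R, ℝ) := fun a => (hT a).fixedPoint (T a)
  have hZ : ∀ a, T a (Z a) = Z a := fun a => (hT a).fixedPoint_isFixedPt
  have hZv : ∀ a r, (hr : r ∈ Icc 0 R) → vV k a (W (Z a)) r = Real.exp (l * r) * Z a ⟨r, hr⟩ := by
    intro a r hr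
    have : T a (Z a) ⟨r, hr⟩ = Z a ⟨r, hr⟩ := by rw [hZ a]
    rw [← this]
    change _ = Real.exp (l * r) * (Real.exp (-(l * r)) * vV k a (W (Z a)) r)
    rw [← mul_assoc, ← Real.exp_add]; simp
  have hZ0 : Z 0 = 0 := by
    symm
    apply (hT 0).fixedPoint_unique
    change T 0 0 = 0
    have hW0 : W 0 = 0 := by
      funext t
      change q t (Real.exp (l * t) * IccExtend hR.le _ t) = 0
      have : IccExtend hR.le (⇑(0 : C(Icc (0:ℝ) R, ℝ))) t = 0 := rfl
      rw [this, mul_zero, hq0]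
    ext ⟨r, hr⟩
    change Real.exp (-(l * r)) * vV k 0 (W 0) r = 0
    rw [hW0]
    simp [vV, vP]
  have hZd : ∀ a b, dist (Z a) (Z b) ≤ 2 * |a - b| := by
    intro a b
    have := (hT a).fixedPoint_lipschitz_in_map (hT b) (C := |a - b|) ?_
    · refine this.trans ?_
      norm_num
      linarith
    · intro z
      rw [ContinuousMap.dist_le (abs_nonneg _)]
      rintro ⟨r, hr0, hrR⟩
      rw [Real.dist_eq]
      change |Real.exp (-(l * r)) * (a + _) - Real.exp (-(l * r)) * (b + _)| ≤ _
      rw [← mul_sub, abs_mul, abs_of_pos (Real.exp_pos _), add_sub_add_right_eq_sub]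
      have : Real.exp (-(l * r)) ≤ 1 := Real.exp_le_one_iff.2 (by nlinarith)
      nlinarith [abs_nonneg (a - b)]
  have hexp : ∀ r, r ≤ R → Real.exp (l * r) ≤ Real.exp (l * R) := fun r hr =>
    Real.exp_le_exp.2 (mul_le_mul_of_nonneg_left hr hlpos.le)
  have hVV : ∀ a b, ∀ r ∈ Icc 0 R, |vV k a (W (Z a)) r - vV k b (W (Z b)) r| ≤ 
      Real.exp (l * R) * (2 * |a - b|) := by
    intro a b r hr
    rw [hZv a r hr, hZv b r hr, ← mul_sub, abs_mul, abs_of_pos (Real.exp_pos _)]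
    have := ContinuousMap.dist_apply_le_dist (f := Z a) (g := Z b) ⟨r, hr⟩
    rw [Real.dist_eq] at this
    have h2 := this.trans (hZd a b)
    have := hexp r hr.2
    gcongr
  refine ⟨fun a => vV k a (W (Z a)), fun a => vP k (W (Z a)), fun a => ⟨?_, ?_, ?_, ?_⟩, 
    2 * Real.exp (l * R) * (1 + R * L), by positivity, ?_, ?_, ?_⟩
  · simp [vV]
  · exact vV_deriv k a _ (hW _)
  · exact vP_cont k _ (hW _)
  · intro r hr
    have h1 := vP_deriv k _ (hW (Z a)) r
    have h2 : W (Z a) r = q r (vV k a (W (Z a)) r) := by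
      rw [hZv a r hr]
      change q r (Real.exp (l * r) * IccExtend hR.le _ r) = _
      rw [IccExtend_of_mem _ _ hr]
    rw [← h2]; exact h1
  · intro a b r hr
    refine (hVV a b r hr).trans ?_
    have : 0 ≤ Real.exp (l * R) * |a - b| * (R * L) := by positivity
    linarith
  · intro a r hr
    have h := hVV a 0 r hr
    rw [hZv 0 r hr, hZ0] at h
    simp only [ContinuousMap.zero_apply, mul_zero, sub_zero] at h
    refine h.trans ?_
    have : 0 ≤ Real.exp (l * R) * |a| * (R * L) := by positivity
    linarith
  · intro a r hr
    have h := hPd (Z a) (Z 0) r hr.1 hr.2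
    have hz : vP k (W (Z 0)) r = 0 := by
      have hW0 : ∀ t, W (Z 0) t = 0 := by
        intro t
        rw [hZ0]
        change q t (Real.exp (l * t) * IccExtend hR.le _ t) = 0
        have : IccExtend hR.le (⇑(0 : C(Icc (0:ℝ) R, ℝ))) t = 0 := rfl
        rw [this, mul_zero, hq0]
      simp [vP, hW0]
    rw [hz, sub_zero] at h
    have h2 := hZd a 0
    rw [sub_zero] at h2
    have h3 := hexp r hr.2
    calc _ ≤ _ := h
      _ ≤ R * L * (2 * |a|) * Real.exp (l * R) := by gcongr
      _ ≤ _ := by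
        have : 0 ≤ Real.exp (l * R) * |a| := by positivity
        linarith


theorem RadSol.dP' {k : ℕ} {R : ℝ} {q : ℝ → ℝ → ℝ} {a : ℝ} {V P : ℝ → ℝ}
    (h : RadSol k R q a V P) (r : ℝ) (hr : 0 < r) (hrR : r ≤ R) :
    HasDerivAt P (-q r (V r) - k * P r / r) r := by
  have h1 := (h.dP r ⟨hr.le, hrR⟩).div (hasDerivAt_pow k r) (pow_pos hr k).ne'
  have h2 : (fun s => s ^ k * P s / s ^ k) =ᶠ[nhds r] P := by
    filter_upwards [lt_mem_nhds hr] with s hs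
    have := (pow_pos hs k).ne'
    field_simp
  have h3 := h1.congr_of_eventuallyEq h2.symm
  refine h3.congr_deriv ?_
  rcases k with _ | k
  · simp
  · simp only [Nat.add_sub_cancel]
    push_cast
    field_simp
    ring

/-- `r u'(r)` for `u = r^m V`. -/
noncomputable def radY (m : ℕ) (V P : ℝ → ℝ) (r : ℝ) : ℝ := m * (r ^ m * V r) + r ^ (m + 1) * P r

theorem RadSol.cY {k : ℕ} {R : ℝ} {q : ℝ → ℝ → ℝ} {a : ℝ} {V P : ℝ → ℝ}
    (h : RadSol k R q a V P) (m : ℕ) : Continuous (radY m V P) := by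
  have := h.cV
  have := h.cP
  unfold radY; fun_prop

theorem RadSol.du {k : ℕ} {R : ℝ} {q : ℝ → ℝ → ℝ} {a : ℝ} {V P : ℝ → ℝ}
    (h : RadSol k R q a V P) (m : ℕ) (r : ℝ) (hr : 0 < r) :
    HasDerivAt (fun s => s ^ m * V s) (radY m V P r / r) r := by
  refine ((hasDerivAt_pow m r).mul (h.dV r)).congr_deriv ?_
  unfold radY
  rcases m with _ | m
  · simp; field_simp
  · simp only [Nat.add_sub_cancel]
    push_cast
    field_simp
    ring

theorem RadSol.dY {m : ℕ} {R : ℝ} {q : ℝ → ℝ → ℝ} {a : ℝ} {V P : ℝ → ℝ}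
    (h : RadSol (2 * m + 1) R q a V P) (r : ℝ) (hr : 0 < r) (hrR : r ≤ R) :
    HasDerivAt (radY m V P) ((m:ℝ) ^ 2 / r * (r ^ m * V r) - r ^ (m + 1) * q r (V r)) r := by
  have h1 := ((h.du m r hr).const_mul (m:ℝ)).add ((hasDerivAt_pow (m+1) r).mul (h.dP' r hr hrR))
  refine h1.congr_deriv ?_
  unfold radY
  simp only [Nat.add_sub_cancel]
  push_cast
  field_simp
  ring

theorem radY_zero (m : ℕ) (hm : 1 ≤ m) (V P : ℝ → ℝ) : radY m V P 0 = 0 := by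
  unfold radY
  have : m ≠ 0 := by omega
  simp [this]

theorem first_zero (V P : ℝ → ℝ) (R : ℝ) (hV : ∀ r, HasDerivAt V (P r) r) (h0 : 0 < V 0)
    (hz : ∃ r ∈ Icc 0 R, V r ≤ 0) :
    ∃ ρ, 0 < ρ ∧ ρ ≤ R ∧ V ρ = 0 ∧ (∀ r ∈ Ico 0 ρ, 0 < V r) ∧ P ρ ≤ 0 := by
  have hc : Continuous V := continuous_iff_continuousAt.2 fun r => (hV r).continuousAt
  have hcomp : IsCompact (Icc 0 R ∩ {r | V r ≤ 0}) :=
    isCompact_Icc.inter_right (isClosed_le hc continuous_const)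
  obtain ⟨r, hr, hr0⟩ := hz
  obtain ⟨ρ, ⟨hρ, hρ0⟩, hmin⟩ := hcomp.exists_isLeast ⟨r, hr, hr0⟩
  have hpos : ∀ r ∈ Ico 0 ρ, 0 < V r := by
    intro s hs
    by_contra hn
    exact absurd (hmin ⟨⟨hs.1, hs.2.le.trans hρ.2⟩, not_lt.1 hn⟩) (not_le.2 hs.2)
  have hρpos : 0 < ρ := by
    rcases hρ.1.eq_or_lt with h | h
    · rw [← h] at hρ0
      exact absurd h0 (not_lt.2 hρ0)
    · exact h
  have hVρ : V ρ = 0 := by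
    refine le_antisymm hρ0 ?_
    have : ρ ∈ closure (Ico 0 ρ) := by
      rw [closure_Ico hρpos.ne]; exact ⟨hρpos.le, le_rfl⟩
    exact closure_minimal (t := {r | 0 ≤ V r}) (fun r hr => (hpos r hr).le)
      (isClosed_le continuous_const hc) this
  refine ⟨ρ, hρpos, hρ.2, hVρ, hpos, ?_⟩
  have h1 := (hV ρ).hasDerivWithinAt (s := Iio ρ)
  rw [hasDerivWithinAt_iff_tendsto_slope' (by simp)] at h1
  refine le_of_tendsto h1 ?_
  filter_upwards [Ioo_mem_nhdsLT hρpos] with s hs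
  rw [slope_def_field, hVρ]
  have := hpos s ⟨hs.1.le, hs.2⟩
  have h3 := hs.2
  exact div_nonpos_of_nonneg_of_nonpos (by linarith) (by linarith)

/-- Positivity by comparison with `J₀`. -/
theorem rad_pos (m : ℕ) (hm : 1 ≤ m) (R : ℝ) (hR : 0 < R) (q : ℝ → ℝ → ℝ) (a : ℝ) (ha : 0 < a)
    (V P : ℝ → ℝ) (h : RadSol (2 * m + 1) R q a V P)
    (hq : ∀ r ∈ Ioo 0 R, 0 < V r → q r (V r) < ((m:ℝ) ^ 2 + besselR0 ^ 2) / R ^ 2 * V r) :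
    ∀ r ∈ Icc 0 R, 0 < V r := by
  by_contra hn
  push Not at hn
  obtain ⟨ρ, hρ, hρR, hVρ, hpos, hPρ⟩ := first_zero V P R h.dV (by rw [h.V0]; exact ha) hn
  obtain ⟨w, D, hw, hD, hD0, hwpos, hwR, hdw, hdD⟩ := bes_compare R hR
  have hmono : StrictMonoOn (fun r => radY m V P r * w r - (r ^ m * V r) * D r) (Icc 0 ρ) := by
    apply strictMonoOn_of_deriv_pos (convex_Icc _ _)
    · have := h.cY m
      have := h.cV
      apply Continuous.continuousOn; fun_prop
    · intro r hr
      rw [interior_Icc] at hr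
      have hrR : r < R := hr.2.trans_le hρR
      have hd := ((h.dY r hr.1 hrR.le).mul (hdw r hr.1)).sub ((h.du m r hr.1).mul (hdD r))
      have hd' := hd.deriv
      have e : deriv (fun r => radY m V P r * w r - (r ^ m * V r) * D r) r = _ := hd'
      rw [e]
      have hV := hpos r ⟨hr.1.le, hr.2⟩
      have hwr := hwpos r ⟨hr.1.le, hrR⟩
      have hq1 := hq r ⟨hr.1, hrR⟩ hV
      have hr0 := hr.1
      have e2 : ((m:ℝ) ^ 2 / r * (r ^ m * V r) - r ^ (m + 1) * q r (V r)) * w r 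
          + radY m V P r * (D r / r) - (radY m V P r / r * D r + 
          r ^ m * V r * -(besselR0 ^ 2 / R ^ 2 * r * w r)) 
          = r ^ (m+1) * w r * (((m:ℝ) ^ 2 / r ^ 2 + besselR0 ^ 2 / R ^ 2) * V r - q r (V r)) := by
        field_simp
        ring
      rw [e2]
      have hm2 : (m:ℝ) ^ 2 / R ^ 2 ≤ (m:ℝ) ^ 2 / r ^ 2 := by
        gcongr
      apply mul_pos (by positivity)
      rw [add_div] at hq1
      nlinarith
  have := hmono ⟨le_rfl, hρ.le⟩ ⟨hρ.le, le_rfl⟩ hρ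
  simp only [hVρ, hD0, radY_zero m hm] at this
  have hwρ : 0 ≤ w ρ := by
    rcases hρR.eq_or_lt with h | h
    · rw [h]; exact hwR
    · exact (hwpos ρ ⟨hρ.le, h⟩).le
  have hY : radY m V P ρ ≤ 0 := by
    unfold radY
    rw [hVρ]
    have : ρ ^ (m+1) * P ρ ≤ 0 := mul_nonpos_of_nonneg_of_nonpos (by positivity) hPρ
    simpa using this
  nlinarith

/-- No double zeros. -/
theorem rad_no_double (k : ℕ) (R : ℝ) (q : ℝ → ℝ → ℝ) (a : ℝ) (ha : 0 < a)
    (V P : ℝ → ℝ) (h : RadSol k R q a V P) (L : ℝ) (hL : ∀ r x, |q r x| ≤ L * |x|)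
    (ρ : ℝ) (hρ : 0 < ρ) (hρR : ρ ≤ R) (h1 : V ρ = 0) (h2 : P ρ = 0) : False := by
  have key : ∀ ε, 0 < ε → ε < ρ → V ε = 0 := by
    intro ε hε hερ
    set C : ℝ := 1 + |L| + 2 * k / ε with hC
    have hmono : MonotoneOn (fun r => Real.exp (C * r) * (V r ^ 2 + P r ^ 2)) (Icc ε ρ) := by
      have hd : ∀ r ∈ Icc ε ρ, HasDerivAt (fun r => Real.exp (C * r) * (V r ^ 2 + P r ^ 2)) 
        (Real.exp (C * r) * (C * (V r ^ 2 + P r ^ 2) + 2 * V r * P r 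
          + 2 * P r * (-q r (V r) - k * P r / r))) r := by
        intro r hr
        have hr0 : 0 < r := hε.trans_le hr.1
        have e1 : HasDerivAt (fun r => Real.exp (C * r)) (Real.exp (C * r) * C) r := by
          simpa using ((hasDerivAt_id r).const_mul C).exp
        have := e1.mul (((h.dV r).pow 2).add ((h.dP' r hr0 (hr.2.trans hρR)).pow 2))
        refine HasDerivAt.congr_deriv this ?_
        simp only [Pi.add_apply, Pi.pow_apply]
        push_cast
        ring
      apply monotoneOn_of_deriv_nonneg (convex_Icc _ _)
      · intro r hr
        exact (hd r hr).continuousAt.continuousWithinAt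
      · intro r hr
        rw [interior_Icc] at hr
        exact (hd r ⟨hr.1.le, hr.2.le⟩).differentiableAt.differentiableWithinAt
      · intro r hr
        rw [interior_Icc] at hr
        rw [(hd r ⟨hr.1.le, hr.2.le⟩).deriv]
        apply mul_nonneg (Real.exp_pos _).le
        have hr0 : 0 < r := hε.trans hr.1
        have a1 : |P r * q r (V r)| ≤ |L| * (|P r| * |V r|) := by
          rw [abs_mul]
          have := hL r (V r)
          have h3 : L * |V r| ≤ |L| * |V r| := by gcongr; exact le_abs_self L
          have := mul_le_mul_of_nonneg_left (this.trans h3) (abs_nonneg (P r))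
          linarith
        have a2 : 2 * (|P r| * |V r|) ≤ V r ^ 2 + P r ^ 2 := by
          nlinarith [sq_nonneg (|P r| - |V r|), sq_abs (P r), sq_abs (V r)]
        have a3 : 2 * P r * (k * P r / r) ≤ 2 * k / ε * (V r ^ 2 + P r ^ 2) := by
          have e : 2 * P r * (k * P r / r) = 2 * k / r * P r ^ 2 := by ring
          rw [e]
          have : 2 * (k:ℝ) / r ≤ 2 * k / ε := by gcongr; exact hr.1.le
          have : (0:ℝ) ≤ 2 * k / ε := by positivity
          nlinarith [sq_nonneg (V r), sq_nonneg (P r)]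
        have a4 := (abs_le.1 a1).2
        have a5 := mul_le_mul_of_nonneg_left a2 (abs_nonneg L)
        have a6 : -(V r ^ 2 + P r ^ 2) ≤ 2 * V r * P r := by nlinarith [sq_nonneg (V r + P r)]
        rw [hC]
        nlinarith
    have := hmono ⟨le_rfl, hερ.le⟩ ⟨hερ.le, le_rfl⟩ hερ.le
    simp only [h1, h2] at this
    have e := Real.exp_pos (C * ε)
    have : V ε ^ 2 + P ε ^ 2 ≤ 0 := by
      by_contra hn
      push Not at hn
      have := mul_pos e hn
      simp at *
      linarith
    nlinarith [sq_nonneg (V ε), sq_nonneg (P ε)]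
  have h0 : (0:ℝ) ∈ closure (Ioo 0 ρ) := by
    rw [closure_Ioo hρ.ne]; exact ⟨le_rfl, hρ.le⟩
  have := closure_minimal (t := {r | V r = 0}) (fun r hr => key r hr.1 hr.2)
      (isClosed_eq h.cV continuous_const) h0
  have h3 : V 0 = 0 := this
  rw [h.V0] at h3
  linarith

theorem le_of_deriv_nonpos' (f f' : ℝ → ℝ) (a b : ℝ) (hab : a ≤ b) (hc : ContinuousOn f (Icc a b))
    (hd : ∀ r ∈ Ioo a b, HasDerivAt f (f' r) r) (hn : ∀ r ∈ Ioo a b, f' r ≤ 0) : f b ≤ f a := by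
  have : AntitoneOn f (Icc a b) := by
    apply antitoneOn_of_deriv_nonpos (convex_Icc _ _) hc
    · intro r hr
      rw [interior_Icc] at hr
      exact (hd r hr).differentiableAt.differentiableWithinAt
    · intro r hr
      rw [interior_Icc] at hr
      rw [(hd r hr).deriv]; exact hn r hr
  exact this ⟨le_rfl, hab⟩ ⟨hab, le_rfl⟩ hab

theorem rad_lin_zero (m : ℕ) (R : ℝ) (hR : 0 < R) (Λ : ℝ) (V P : ℝ → ℝ)
    (h : RadSol (2 * m + 1) R (fun _ y => Λ * y) 1 V P)
    (hΛ : 12 * (1 + (m:ℝ) ^ 2 * (2 * Real.log 2 - 1)) < Λ * R ^ 2) :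
    ∃ r ∈ Icc 0 R, V r ≤ 0 := by
  by_contra hn
  push Not at hn
  set Q : ℝ → ℝ := fun r => m + r * P r / V r with hQ
  have hcQ : ContinuousOn Q (Icc 0 R) := by
    have h1 := h.cV
    have h2 := h.cP
    apply ContinuousOn.add continuousOn_const
    apply ContinuousOn.div (by fun_prop) h1.continuousOn
    intro r hr; exact (hn r hr).ne'
  have hdQ : ∀ r, 0 < r → r ≤ R → HasDerivAt Q ((m:ℝ) ^ 2 / r - Λ * r - Q r ^ 2 / r) r := by
    intro r hr hrR
    have hV := hn r ⟨hr.le, hrR⟩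
    have := (((hasDerivAt_id r).mul (h.dP' r hr hrR)).div (h.dV r) hV.ne').const_add (m:ℝ)
    refine HasDerivAt.congr_deriv this ?_
    simp only [hQ, id, Pi.mul_apply]
    push_cast
    field_simp
    ring
  -- first half
  have e1 := le_of_deriv_nonpos' (fun r => r ^ 2 * Q r - ((1 + (m:ℝ)^2) * r ^ 2 / 2 - Λ * r ^ 4 / 4))
    (fun r => (2 * r * Q r + r ^ 2 * ((m:ℝ) ^ 2 / r - Λ * r - Q r ^ 2 / r)) 
      - ((1 + (m:ℝ)^2) * (2 * r) / 2 - Λ * (4 * r ^ 3) / 4)) 0 (R/2) (by linarith) ?_ ?_ ?_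
  rotate_left
  · have := hcQ.mono (Icc_subset_Icc_right (by linarith : R/2 ≤ R))
    fun_prop
  · intro r hr
    have hd := hdQ r hr.1 (by linarith [hr.2])
    have := ((hasDerivAt_pow 2 r).mul hd).sub ((((hasDerivAt_pow 2 r).const_mul 
      (1 + (m:ℝ)^2)).div_const 2).sub (((hasDerivAt_pow 4 r).const_mul Λ).div_const 4))
    refine HasDerivAt.congr_deriv this ?_
    push_cast
    ring
  · intro r hr
    have hr0 := hr.1
    have : (2 * r * Q r + r ^ 2 * ((m:ℝ) ^ 2 / r - Λ * r - Q r ^ 2 / r)) 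
      - ((1 + (m:ℝ)^2) * (2 * r) / 2 - Λ * (4 * r ^ 3) / 4) = -(r * (Q r - 1) ^ 2) := by
      field_simp; ring
    rw [this]
    have : 0 ≤ r * (Q r - 1) ^ 2 := by positivity
    linarith
  -- second half
  have e2 := le_of_deriv_nonpos' (fun r => (R - r) ^ 2 * Q r - (r ^ 2 / 2 + 
      (m:ℝ)^2 * (R ^ 2 * Real.log r - 2 * R * r + r ^ 2 / 2) 
      - Λ * (R ^ 2 * r ^ 2 / 2 - 2 * R * r ^ 3 / 3 + r ^ 4 / 4)))
    (fun r => (-(2 * (R - r)) * Q r + (R - r) ^ 2 * ((m:ℝ) ^ 2 / r - Λ * r - Q r ^ 2 / r)) 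
      - (r + (m:ℝ)^2 * (R ^ 2 * r⁻¹ - 2 * R + r) 
      - Λ * (R ^ 2 * r - 2 * R * r ^ 2 + r ^ 3))) (R/2) R (by linarith) ?_ ?_ ?_
  rotate_left
  · have := hcQ.mono (Icc_subset_Icc_left (by linarith : 0 ≤ R/2))
    have hlog : ContinuousOn Real.log (Icc (R/2) R) := by
      apply Real.continuousOn_log.mono
      intro r hr
      have : 0 < r := by linarith [hr.1]
      exact this.ne'
    fun_prop
  · intro r hr
    have hr0 : 0 < r := by linarith [hr.1]
    have hd := hdQ r hr0 hr.2.le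
    have h1 : HasDerivAt (fun r => (R - r) ^ 2) (-(2 * (R - r))) r := by
      refine HasDerivAt.congr_deriv (((hasDerivAt_id r).const_sub R).pow 2) ?_
      simp
    have h2 : HasDerivAt (fun r => R ^ 2 * Real.log r - 2 * R * r + r ^ 2 / 2) 
        (R ^ 2 * r⁻¹ - 2 * R + r) r := by
      refine HasDerivAt.congr_deriv ((((Real.hasDerivAt_log hr0.ne').const_mul (R^2)).sub 
        ((hasDerivAt_id r).const_mul (2 * R))).add ((hasDerivAt_pow 2 r).div_const 2)) ?_
      push_cast; ring
    have h3 : HasDerivAt (fun r => R ^ 2 * r ^ 2 / 2 - 2 * R * r ^ 3 / 3 + r ^ 4 / 4) 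
        (R ^ 2 * r - 2 * R * r ^ 2 + r ^ 3) r := by
      refine HasDerivAt.congr_deriv (((((hasDerivAt_pow 2 r).const_mul (R^2)).div_const 2).sub 
        (((hasDerivAt_pow 3 r).const_mul (2 * R)).div_const 3)).add 
        ((hasDerivAt_pow 4 r).div_const 4)) ?_
      push_cast; ring
    have := (h1.mul hd).sub ((((hasDerivAt_pow 2 r).div_const 2).add (h2.const_mul ((m:ℝ)^2))).sub
      (h3.const_mul Λ))
    refine HasDerivAt.congr_deriv this ?_
    push_cast
    ring
  · intro r hr
    have hr0 : 0 < r := by linarith [hr.1]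
    have : (-(2 * (R - r)) * Q r + (R - r) ^ 2 * ((m:ℝ) ^ 2 / r - Λ * r - Q r ^ 2 / r)) 
      - (r + (m:ℝ)^2 * (R ^ 2 * r⁻¹ - 2 * R + r) 
      - Λ * (R ^ 2 * r - 2 * R * r ^ 2 + r ^ 3)) = -(((R - r) * Q r + r) ^ 2 / r) := by
      field_simp; ring
    rw [this]
    have : 0 ≤ ((R - r) * Q r + r) ^ 2 / r := by positivity
    linarith
  beta_reduce at e1 e2
  rw [Real.log_div hR.ne' two_ne_zero] at e2
  have hf : R ^ 2 / 24 * (12 * (1 + (m:ℝ) ^ 2 * (2 * Real.log 2 - 1)) - Λ * R ^ 2) < 0 :=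
    mul_neg_of_pos_of_neg (by positivity) (by linarith)
  ring_nf at e1 e2 hf
  linarith

theorem rad_large (m : ℕ) (hm : 1 ≤ m) (R : ℝ) (hR : 0 < R) (Λ Λ' β γ : ℝ) (hβ : 0 ≤ β) (hγ : 0 < γ)
    (hΛ : Λ' < Λ) (ψ Pψ : ℝ → ℝ) (hψ : RadSol (2 * m + 1) R (fun _ y => Λ' * y) 1 ψ Pψ)
    (hz : ∃ r ∈ Icc 0 R, ψ r ≤ 0) (V P : ℝ → ℝ → ℝ)
    (h : ∀ a, RadSol (2 * m + 1) R
      (fun r y => Λ * y - β * (y / (1 + γ * r ^ (2 * m) * y ^ 2))) a (V a) (P a))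
    (C : ℝ) (hC : 0 < C) (hP : ∀ a, ∀ r ∈ Icc 0 R, |P a r| ≤ C * |a|) :
    ∃ a > 0, ∃ r ∈ Icc 0 R, V a r ≤ 0 := by
  by_contra hn
  push Not at hn
  obtain ⟨ρ, hρ, hρR, hψρ, hpos, hPρ⟩ := first_zero ψ Pψ R hψ.dV (by rw [hψ.V0]; exact one_pos) hz
  have cψ := hψ.cV
  set A : ℝ → ℝ := fun r => ∫ t in (0:ℝ)..r, t ^ (m+1) * ψ t with hA
  set B : ℝ → ℝ := fun r => ∫ t in (0:ℝ)..r, t ^ (2*m+1) * ψ t with hB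
  have dA : ∀ r, HasDerivAt A (r ^ (m+1) * ψ r) r := fun r =>
    (Continuous.integral_hasStrictDerivAt (by fun_prop) 0 r).hasDerivAt
  have dB : ∀ r, HasDerivAt B (r ^ (2*m+1) * ψ r) r := fun r =>
    (Continuous.integral_hasStrictDerivAt (by fun_prop) 0 r).hasDerivAt
  have cA : Continuous A := continuous_iff_continuousAt.2 fun r => (dA r).continuousAt
  have cB : Continuous B := continuous_iff_continuousAt.2 fun r => (dB r).continuousAt
  have A0 : A 0 = 0 := by simp [hA]
  have B0 : B 0 = 0 := by simp [hB]
  set δ := min ρ (1 / (2 * C)) with hδ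
  have hδ0 : 0 < δ := by rw [hδ]; positivity
  have hδρ : δ ≤ ρ := min_le_left _ _
  have hδC : δ * C ≤ 1 / 2 := by
    have : δ ≤ 1 / (2 * C) := min_le_right _ _
    calc δ * C ≤ 1 / (2 * C) * C := by gcongr
      _ = 1 / 2 := by field_simp
  have hb : 0 < B δ := by
    apply intervalIntegral.intervalIntegral_pos_of_pos_on
    · apply Continuous.intervalIntegrable; fun_prop
    · intro t ht
      have := hpos t ⟨ht.1.le, ht.2.trans_le hδρ⟩
      have := ht.1
      positivity
    · exact hδ0
  have hAρ : 0 < A ρ := by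
    apply intervalIntegral.intervalIntegral_pos_of_pos_on
    · apply Continuous.intervalIntegrable; fun_prop
    · intro t ht
      have := hpos t ⟨ht.1.le, ht.2⟩
      have := ht.1
      positivity
    · exact hρ
  set K := β * (1 + 1 / γ) with hK
  have hK0 : 0 ≤ K := by positivity
  set ε := Λ - Λ' with hε
  have hε0 : 0 < ε := by rw [hε]; linarith
  obtain ⟨a, ha, hab⟩ : ∃ a > 0, K * A ρ < ε * (a / 2) * B δ := by
    refine ⟨2 * (K * A ρ + 1) / (ε * B δ), by positivity, ?_⟩
    have : ε * (2 * (K * A ρ + 1) / (ε * B δ) / 2) * B δ = K * A ρ + 1 := by field_simp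
    linarith
  have hV := hn a ha
  have hs := h a
  have cV := hs.cV
  have cY := hs.cY m
  have cYψ := hψ.cY m
  have hlow : ∀ r ∈ Icc 0 δ, a / 2 ≤ V a r := by
    intro r hr
    have := le_of_deriv_nonpos' (fun r => -(V a r) - C * a * r) (fun r => -(P a r) - C * a) 0 r hr.1
      (by fun_prop) ?_ ?_
    · beta_reduce at this
      rw [hs.V0] at this
      have h3 : C * a * r ≤ a / 2 := by
        have : r * C ≤ δ * C := mul_le_mul_of_nonneg_right hr.2 hC.le
        nlinarith
      linarith
    · intro s _
      refine HasDerivAt.congr_deriv ((hs.dV s).neg.sub ((hasDerivAt_id s).const_mul (C * a))) ?_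
      ring
    · intro s hss
      have := hP a s ⟨hss.1.le, hss.2.le.trans (hr.2.trans (hδρ.trans hρR))⟩
      rw [abs_of_pos ha] at this
      linarith [(abs_le.1 this).1]
  set W : ℝ → ℝ := fun r => radY m (V a) (P a) r * (r ^ m * ψ r) - (r ^ m * V a r) * radY m ψ Pψ r
    with hW
  have cW : Continuous W := by rw [hW]; fun_prop
  set W' : ℝ → ℝ := fun r => r ^ (m+1) * ψ r * (β * ((r ^ m * V a r) / (1 + γ * (r ^ m * V a r) ^ 2))
    - ε * (r ^ m * V a r)) with hW'
  have dW : ∀ r, 0 < r → r ≤ R → HasDerivAt W (W' r) r := by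
    intro r hr hrR
    have := ((hs.dY r hr hrR).mul (hψ.du m r hr)).sub ((hs.du m r hr).mul (hψ.dY r hr hrR))
    refine HasDerivAt.congr_deriv this ?_
    simp only [hW', hε]
    have e : γ * (r ^ m * V a r) ^ 2 = γ * r ^ (2 * m) * V a r ^ 2 := by ring
    rw [e]
    have e2 : r ^ m * V a r / (1 + γ * r ^ (2*m) * V a r ^ 2) = 
      r ^ m * (V a r / (1 + γ * r ^ (2*m) * V a r ^ 2)) := by ring
    rw [e2]
    generalize V a r / (1 + γ * r ^ (2*m) * V a r ^ 2) = X
    field_simp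
    ring
  have W0 : W 0 = 0 := by simp [hW, radY_zero m hm]
  have hWle : ∀ r ∈ Ioo 0 ρ, W' r ≤ r ^ (m+1) * ψ r * (K - ε * (r ^ m * V a r)) := by
    intro r hr
    have h1 := hpos r ⟨hr.1.le, hr.2⟩
    have h2 := hr.1
    have h3 := hV r ⟨hr.1.le, hr.2.le.trans hρR⟩
    simp only [hW', hK]
    gcongr
    generalize r ^ m * V a r = u
    rw [div_le_iff₀ (by positivity)]
    have : (1 + 1 / γ) * (1 + γ * u ^ 2) = 1 + u ^ 2 + (1 / γ + γ * u ^ 2) := by field_simp; ring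
    rw [this]
    have : 0 ≤ 1 / γ + γ * u ^ 2 := by positivity
    nlinarith [sq_nonneg (u - 1)]
  have s1 := le_of_deriv_nonpos' (fun r => W r - (K * A r - ε * (a / 2) * B r)) 
    (fun r => W' r - (K * (r ^ (m+1) * ψ r) - ε * (a/2) * (r ^ (2*m+1) * ψ r))) 0 δ hδ0.le 
    (by fun_prop) ?_ ?_
  rotate_left
  · intro r hr
    exact (dW r hr.1 (hr.2.le.trans (hδρ.trans hρR))).sub 
      (((dA r).const_mul K).sub ((dB r).const_mul _))
  · intro r hr
    have h1 := hWle r ⟨hr.1, hr.2.trans_le hδρ⟩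
    have h2 := hlow r ⟨hr.1.le, hr.2.le⟩
    have h3 := hpos r ⟨hr.1.le, hr.2.trans_le hδρ⟩
    have hr0 := hr.1
    have h4 : 0 ≤ r ^ (m+1) * ψ r * (ε * (r ^ m * (V a r - a / 2))) := by
      have : 0 ≤ V a r - a / 2 := by linarith
      positivity
    have e : ε * (a/2) * (r ^ (2*m+1) * ψ r) = r ^ (m+1) * ψ r * (ε * (r ^ m * (a / 2))) := by ring
    rw [e]
    nlinarith
  have s2 := le_of_deriv_nonpos' (fun r => W r - K * A r) 
    (fun r => W' r - K * (r ^ (m+1) * ψ r)) δ ρ hδρ (by fun_prop) ?_ ?_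
  rotate_left
  · intro r hr
    exact (dW r (hδ0.trans hr.1) (hr.2.le.trans hρR)).sub ((dA r).const_mul K)
  · intro r hr
    have hr0 := hδ0.trans hr.1
    have h1 := hWle r ⟨hr0, hr.2⟩
    have h2 := hV r ⟨hr0.le, hr.2.le.trans hρR⟩
    have h3 := hpos r ⟨hr0.le, hr.2⟩
    have h4 : 0 ≤ r ^ (m+1) * ψ r * (ε * (r ^ m * V a r)) := by positivity
    nlinarith
  beta_reduce at s1 s2
  rw [W0, A0, B0] at s1
  have hWρ : 0 ≤ W ρ := by
    simp only [hW, radY, hψρ]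
    have h2 := hV ρ ⟨hρ.le, hρR⟩
    have : 0 ≤ ρ ^ m * V a ρ * (ρ ^ (m+1) * (-Pψ ρ)) := by
      have : 0 ≤ -Pψ ρ := by linarith
      positivity
    nlinarith
  linarith

theorem frac_lip (c : ℝ) (hc : 0 ≤ c) (x y : ℝ) :
    |x / (1 + c * x ^ 2) - y / (1 + c * y ^ 2)| ≤ |x - y| := by
  have hx : 0 < 1 + c * x ^ 2 := by positivity
  have hy : 0 < 1 + c * y ^ 2 := by positivity
  have e : x / (1 + c * x ^ 2) - y / (1 + c * y ^ 2) =
      (x - y) * ((1 - c * x * y) / ((1 + c * x ^ 2) * (1 + c * y ^ 2))) := by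
    field_simp; ring
  rw [e, abs_mul]
  refine mul_le_of_le_one_right (abs_nonneg _) ?_
  rw [abs_div, abs_of_pos (mul_pos hx hy), div_le_one (mul_pos hx hy), abs_le]
  have h1 : 0 ≤ c * (x - y) ^ 2 := by positivity
  have h2 : 0 ≤ c * (x + y) ^ 2 := by positivity
  have h3 : 0 ≤ c * x ^ 2 * (c * y ^ 2) := by positivity
  have h4 : 0 ≤ c * x ^ 2 := by positivity
  have h5 : 0 ≤ c * y ^ 2 := by positivity
  constructor <;> nlinarith

/-- The shooting argument. -/
theorem rad_main (m : ℕ) (hm : 1 ≤ m) (R : ℝ) (hR : 0 < R) (α κ : ℝ) (hα : 0 < α)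
    (h1 : 12 * (1 + (m:ℝ) ^ 2 * (2 * Real.log 2 - 1)) < (2 / α - 2 * κ) * R ^ 2)
    (h2 : 0 < ((m:ℝ) ^ 2 + besselR0 ^ 2) / R ^ 2 + 2 * κ) :
    ∃ a > 0, ∃ V P : ℝ → ℝ, RadSol (2 * m + 1) R
      (fun r y => (2 / α - 2 * κ) * y - 2 / α * (y / (1 + α * r ^ (2 * m) * y ^ 2))) a V P ∧
      (∀ r ∈ Ico 0 R, 0 < V r) ∧ V R = 0 := by
  set Λ := 2 / α - 2 * κ with hΛ
  set q : ℝ → ℝ → ℝ := fun r y => Λ * y - 2 / α * (y / (1 + α * r ^ (2 * m) * y ^ 2)) with hq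
  have hden : ∀ r y : ℝ, 0 < 1 + α * r ^ (2 * m) * y ^ 2 := by
    intro r y
    have : 0 ≤ r ^ (2 * m) := by rw [pow_mul]; positivity
    positivity
  have hqc : Continuous (Function.uncurry q) := by
    have : Continuous fun p : ℝ × ℝ => p.2 / (1 + α * p.1 ^ (2 * m) * p.2 ^ 2) := by
      apply Continuous.div (by fun_prop) (by fun_prop)
      intro p; exact (hden p.1 p.2).ne'
    change Continuous fun p : ℝ × ℝ => 
      Λ * p.2 - 2 / α * (p.2 / (1 + α * p.1 ^ (2 * m) * p.2 ^ 2))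
    fun_prop
  set L := |Λ| + 2 / α with hL
  have hL0 : 0 < L := by positivity
  have hLip : ∀ r x y, |q r x - q r y| ≤ L * |x - y| := by
    intro r x y
    have hc : 0 ≤ α * r ^ (2 * m) := by
      have : 0 ≤ r ^ (2 * m) := by rw [pow_mul]; positivity
      positivity
    have e : q r x - q r y = Λ * (x - y) - 2 / α * 
      (x / (1 + α * r ^ (2 * m) * x ^ 2) - y / (1 + α * r ^ (2 * m) * y ^ 2)) := by
      simp only [hq]; ring
    rw [e]
    refine (abs_sub _ _).trans ?_
    rw [abs_mul, abs_mul, abs_of_pos (by positivity : 0 < 2 / α), hL, add_mul]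
    exact add_le_add le_rfl (mul_le_mul_of_nonneg_left (frac_lip _ hc x y) (by positivity))
  have hq0 : ∀ r, q r 0 = 0 := by intro r; simp [hq]
  obtain ⟨V, P, hs, C, hC, hVV, hVb, hPb⟩ := rad_exists (2 * m + 1) R hR q hqc L hL0 hLip hq0
  -- large data
  obtain ⟨a1, ha1, hz1⟩ : ∃ a > 0, ∃ r ∈ Icc 0 R, V a r ≤ 0 := by
    obtain ⟨Λ', hl1, hl2⟩ : ∃ Λ', 12 * (1 + (m:ℝ) ^ 2 * (2 * Real.log 2 - 1)) / R ^ 2 < Λ' ∧ Λ' < Λ := by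
      apply exists_between
      rw [div_lt_iff₀ (by positivity)]; exact h1
    rw [div_lt_iff₀ (by positivity)] at hl1
    obtain ⟨ψ, Pψ, hψ, -⟩ := rad_exists (2 * m + 1) R hR (fun _ y => Λ' * y) (by
      change Continuous fun p : ℝ × ℝ => Λ' * p.2
      fun_prop) (|Λ'| + 1) (by positivity) (by
      intro r x y
      rw [← mul_sub, abs_mul]
      nlinarith [abs_nonneg (x - y)]) (by intro r; simp)
    exact rad_large m hm R hR Λ Λ' (2 / α) α (by positivity) hα hl2 (ψ 1) (Pψ 1) (hψ 1)
      (rad_lin_zero m R hR Λ' _ _ (hψ 1) hl1) V P hs C hC hPb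
  -- small data
  obtain ⟨a0, ha0, hsmall⟩ : ∃ a0 > 0, ∀ a, 0 < a → a < a0 → ∀ r ∈ Icc 0 R, 0 < V a r := by
    set η := ((m:ℝ) ^ 2 + besselR0 ^ 2) / R ^ 2 + 2 * κ with hη
    set M := 2 * (R ^ m * C) ^ 2 with hM
    have hM0 : 0 < M := by positivity
    refine ⟨Real.sqrt (η / M), Real.sqrt_pos.2 (by positivity), ?_⟩
    intro a ha haa
    have haη : M * a ^ 2 < η := by
      rw [Real.lt_sqrt ha.le, lt_div_iff₀ hM0] at haa
      linarith
    refine rad_pos m hm R hR q a ha (V a) (P a) (hs a) ?_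
    intro r hr hVr
    have hb := hVb a r ⟨hr.1.le, hr.2.le⟩
    rw [abs_of_pos hVr, abs_of_pos ha] at hb
    have hr0 := hr.1
    have hx : r ^ m * V a r ≤ R ^ m * (C * a) := by
      have := hr.2.le
      gcongr
    have hx2 : (r ^ m * V a r) ^ 2 ≤ (R ^ m * (C * a)) ^ 2 := by gcongr
    have e : q r (V a r) = V a r * (2 * (r ^ m * V a r) ^ 2 / (1 + α * r ^ (2 * m) * V a r ^ 2) - 2 * κ) := by
      simp only [hq, hΛ]
      have := hden r (V a r)
      field_simp
      ring
    have hle : 2 * (r ^ m * V a r) ^ 2 / (1 + α * r ^ (2 * m) * V a r ^ 2) ≤ 2 * (r ^ m * V a r) ^ 2 := by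
      apply div_le_self (by positivity)
      have : 0 ≤ α * r ^ (2 * m) * V a r ^ 2 := by positivity
      linarith
    rw [e, mul_comm]
    apply mul_lt_mul_of_pos_right _ hVr
    have : M * a ^ 2 = 2 * (R ^ m * (C * a)) ^ 2 := by rw [hM]; ring
    linarith
  set S : Set ℝ := {a | 0 < a ∧ ∃ r ∈ Icc 0 R, V a r ≤ 0} with hS
  have hSne : S.Nonempty := ⟨a1, ha1, hz1⟩
  have hSlb : ∀ a ∈ S, a0 ≤ a := by
    rintro a ⟨ha, r, hr, hVr⟩
    by_contra hn
    exact absurd (hsmall a ha (not_le.1 hn) r hr) (not_lt.2 hVr)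
  have hSbdd : BddBelow S := ⟨a0, hSlb⟩
  set b := sInf S with hb
  have hb0 : 0 < b := ha0.trans_le (le_csInf hSne hSlb)
  have hlt : ∀ a, 0 < a → a < b → ∀ r ∈ Icc 0 R, 0 < V a r := by
    intro a ha hab r hr
    by_contra hn
    exact absurd (csInf_le hSbdd (⟨ha, r, hr, not_lt.1 hn⟩ : a ∈ S)) (not_le.2 hab)
  have hnn : ∀ r ∈ Icc 0 R, 0 ≤ V b r := by
    intro r hr
    by_contra hn
    push Not at hn
    obtain ⟨a, hal, har⟩ : ∃ a, max 0 (b + V b r / C) < a ∧ a < b := by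
      apply exists_between
      apply max_lt hb0
      have : V b r / C < 0 := div_neg_of_neg_of_pos hn hC
      linarith
    have ha0 : 0 < a := (le_max_left _ _).trans_lt hal
    have ha2 : b + V b r / C < a := (le_max_right _ _).trans_lt hal
    have h3 := hlt a ha0 har r hr
    have h4 := hVV b a r hr
    rw [abs_of_pos (by linarith : 0 < b - a)] at h4
    have h5 := (abs_le.1 h4).1
    have h6 : C * (b - a) < -V b r := by
      have : b - a < -(V b r / C) := by linarith
      have := mul_lt_mul_of_pos_left this hC
      have e : C * -(V b r / C) = -V b r := by field_simp
      linarith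
    linarith
  have hzero : ∃ r ∈ Icc 0 R, V b r ≤ 0 := by
    by_contra hn
    push Not at hn
    obtain ⟨r0, hr0, hmin⟩ := isCompact_Icc.exists_isMinOn (nonempty_Icc.2 hR.le) 
      (hs b).cV.continuousOn
    have hμ := hn r0 hr0
    obtain ⟨a, haS, hab⟩ : ∃ a ∈ S, a < b + V b r0 / C := by
      apply exists_lt_of_csInf_lt hSne
      have : 0 < V b r0 / C := by positivity
      linarith
    obtain ⟨ha, r, hr, hVr⟩ := haS
    have hba : b ≤ a := csInf_le hSbdd ⟨ha, r, hr, hVr⟩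
    have h4 := hVV a b r hr
    rw [abs_of_nonneg (by linarith : 0 ≤ a - b)] at h4
    have h5 := (abs_le.1 h4).1
    have h6 : C * (a - b) < V b r0 := by
      have : a - b < V b r0 / C := by linarith
      have := mul_lt_mul_of_pos_left this hC
      have e : C * (V b r0 / C) = V b r0 := by field_simp
      linarith
    have h7 : V b r0 ≤ V b r := hmin hr
    linarith
  obtain ⟨ρ, hρ, hρR, hVρ, hpos, hPρ⟩ := first_zero (V b) (P b) R (hs b).dV 
    (by rw [(hs b).V0]; exact hb0) hzero
  have hρeq : ρ = R := by
    by_contra hne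
    have hlt : ρ < R := lt_of_le_of_ne hρR hne
    have hloc : IsLocalMin (V b) ρ := by
      filter_upwards [Ioo_mem_nhds hρ hlt] with r hr
      rw [hVρ]; exact hnn r ⟨hr.1.le, hr.2.le⟩
    have hP0 : P b ρ = 0 := hloc.hasDerivAt_eq_zero ((hs b).dV ρ)
    exact rad_no_double (2 * m + 1) R q b hb0 (V b) (P b) (hs b) L (by
      intro r x
      have := hLip r x 0
      rw [hq0, sub_zero, sub_zero] at this
      exact this) ρ hρ hρR hVρ hP0
  subst hρeq
  exact ⟨b, hb0, V b, P b, hs b, hpos, hVρ⟩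

/-- existence of positive solutions for a range of propagation constants. -/
theorem stmt17 (α : ℝ) (hα : 0 < α) (n : ℤ) (hn : 1 ≤ |n|) (R κ : ℝ) (hR0 : 0 < R)
    (hR : R > Real.sqrt (6 * (1 + (n : ℝ) ^ 2 * (2 * Real.log 2 - 1)) / (α⁻¹ - κ)))
    (hκ1 : -((n : ℝ) ^ 2 + besselR0 ^ 2) / (2 * R ^ 2) < κ)
    (hκ2 : κ < α⁻¹ - ((n : ℝ) ^ 2 + besselR0 ^ 2) / (2 * R ^ 2)) :
    ∃ u : ℝ → ℝ, IsVortexSol α n κ R u ∧ FiniteEnergy α R u ∧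
      ∀ r ∈ Ioo (0 : ℝ) R, 0 < u r := by
  obtain ⟨m, hm⟩ : ∃ m : ℕ, m = n.natAbs := ⟨_, rfl⟩
  have hm1 : 1 ≤ m := by
    rw [Int.abs_eq_natAbs] at hn; omega
  have hmn : (m : ℝ) ^ 2 = (n : ℝ) ^ 2 := by
    rw [hm, Nat.cast_natAbs]; push_cast; exact sq_abs _
  rw [← hmn] at hR hκ1 hκ2
  have hpos : 0 < α⁻¹ - κ := by
    have : 0 ≤ ((m:ℝ) ^ 2 + besselR0 ^ 2) / (2 * R ^ 2) := by positivity
    linarith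
  have h1 : 12 * (1 + (m:ℝ) ^ 2 * (2 * Real.log 2 - 1)) < (2 / α - 2 * κ) * R ^ 2 := by
    have := (Real.sqrt_lt' hR0).1 hR
    rw [div_lt_iff₀ hpos] at this
    have e : (2 / α - 2 * κ) = 2 * (α⁻¹ - κ) := by ring
    rw [e]; linarith
  have h2 : 0 < ((m:ℝ) ^ 2 + besselR0 ^ 2) / R ^ 2 + 2 * κ := by
    have e : -((m:ℝ) ^ 2 + besselR0 ^ 2) / (2 * R ^ 2) = 
      -(((m:ℝ) ^ 2 + besselR0 ^ 2) / R ^ 2) / 2 := by field_simp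
    rw [e] at hκ1; linarith
  obtain ⟨a, ha, V, P, h, hVpos, hVR⟩ := rad_main m hm1 R hR0 α κ hα h1 h2
  have cV := h.cV
  have cP := h.cP
  have hdu : ∀ r, 0 < r → deriv (fun s => s ^ m * V s) r = radY m V P r / r := fun r hr =>
    (h.du m r hr).deriv
  refine ⟨fun r => r ^ m * V r, ⟨by fun_prop, ?_, ?_, ?_, ?_⟩, ?_, ?_⟩
  · intro r hr
    refine ⟨(h.du m r hr.1).differentiableAt, ?_⟩
    have e : deriv (fun s => s ^ m * V s) =ᶠ[nhds r] fun s => radY m V P s / s := by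
      filter_upwards [lt_mem_nhds hr.1] with s hs
      exact hdu s hs
    exact (((h.dY r hr.1 hr.2.le).differentiableAt).div differentiableAt_id 
      hr.1.ne').congr_of_eventuallyEq e
  · have : m ≠ 0 := by omega
    simp [this]
  · simp [hVR]
  · intro r hr
    have e : (fun s => s * deriv (fun s => s ^ m * V s) s) =ᶠ[nhds r] radY m V P := by
      filter_upwards [lt_mem_nhds hr.1] with s hs
      rw [hdu s hs]; field_simp
    rw [e.deriv_eq, (h.dY r hr.1 hr.2.le).deriv, ← hmn]
    beta_reduce
    have hr0 := hr.1
    have hd : 0 < 1 + α * (r ^ m * V r) ^ 2 := by positivity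
    have e2 : α * r ^ (2 * m) * V r ^ 2 = α * (r ^ m * V r) ^ 2 := by ring
    rw [e2]
    have e3 : r ^ (m + 1) * ((2 / α - 2 * κ) * V r - 2 / α * (V r / (1 + α * (r ^ m * V r) ^ 2))) 
      = r * ((2 / α - 2 * κ) * (r ^ m * V r) 
        - 2 / α * ((r ^ m * V r) / (1 + α * (r ^ m * V r) ^ 2))) := by ring
    rw [e3]
    generalize r ^ m * V r = u at *
    field_simp
    ring
  · unfold FiniteEnergy
    have hc : Continuous fun r => r * ((m:ℝ) * (r ^ (m - 1) * V r) + r ^ m * P r) ^ 2 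
        + r ^ (2 * m - 1) * V r ^ 2 + r * Real.log (1 + α * (r ^ m * V r) ^ 2) := by
      have : Continuous fun r => Real.log (1 + α * (r ^ m * V r) ^ 2) := by
        apply Continuous.log (by fun_prop)
        intro r
        have : 0 < 1 + α * (r ^ m * V r) ^ 2 := by positivity
        exact this.ne'
      fun_prop
    have hi := (hc.continuousOn (s := Icc 0 R)).integrableOn_compact (μ := volume) isCompact_Icc
    refine (hi.mono_set Ioo_subset_Icc_self).congr_fun ?_ measurableSet_Ioo
    intro r hr
    beta_reduce
    have hr0 := hr.1
    rw [hdu r hr.1]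
    obtain ⟨j, rfl⟩ : ∃ j, m = j + 1 := ⟨m - 1, by omega⟩
    have e1 : 2 * (j + 1) - 1 = 2 * j + 1 := by omega
    have e2 : radY (j+1) V P r / r = ((j+1 : ℕ):ℝ) * (r ^ j * V r) + r ^ (j+1) * P r := by
      unfold radY; field_simp; ring
    rw [e1, e2, Nat.add_sub_cancel]
    congr 2
    field_simp
    ring
  · intro r hr
    have := hVpos r ⟨hr.1.le, hr.2⟩
    have := hr.1
    positivity
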